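/- Let 2 ≤ n ≤ m. The 3-gonality of the rook graph K_n □ K_m equals n·m. -/

import Mathlib

/-- Decidability of adjacency in a box product of simple graphs. -/
instance {α β : Type*} (G : SimpleGraph α) (H : SimpleGraph β) [DecidableEq α] [DecidableEq β]
    [DecidableRel G.Adj] [DecidableRel H.Adj] : DecidableRel (G □ H).Adj := fun _ _ =>
  decidable_of_iff _ SimpleGraph.boxProd_adj.symm

/-- The degree of a divisor: the sum of its values. -/
def degD {V : Type*} [Fintype V] (D : V → ℤ) : ℤ := ∑ v, D v

/-- A divisor is effective if all its values are nonnegative. -/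
def Effective {V : Type*} (D : V → ℤ) : Prop := ∀ v, 0 ≤ D v

/-- The number of edges from the vertex `v` to the vertex set `A`. -/
def edgesTo {V : Type*} [DecidableEq V] (G : SimpleGraph V) [DecidableRel G.Adj]
    (v : V) (A : Finset V) : ℕ := (A.filter (fun u => G.Adj v u)).card

/-- The divisor obtained from `D` by firing the vertex subset `A`: every vertex of `A`
sends one chip along each edge leaving `A`. -/
def fire {V : Type*} [Fintype V] [DecidableEq V] (G : SimpleGraph V) [DecidableRel G.Adj]
    (D : V → ℤ) (A : Finset V) : V → ℤ :=
  fun v => if v ∈ A then D v - edgesTo G v Aᶜ else D v + edgesTo G v A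

/-- Two divisors are equivalent if one is obtained from the other by a finite
sequence of subset firings. -/
def LinEquiv {V : Type*} [Fintype V] [DecidableEq V] (G : SimpleGraph V) [DecidableRel G.Adj]
    (D D' : V → ℤ) : Prop :=
  Relation.ReflTransGen (fun D₁ D₂ => ∃ A : Finset V, D₂ = fire G D₁ A) D D'

/-- A divisor `D` has rank at least `r` if for every effective divisor `E` of degree `r`,
`D - E` is equivalent to an effective divisor. -/
def RankGE {V : Type*} [Fintype V] [DecidableEq V] (G : SimpleGraph V) [DecidableRel G.Adj]
    (D : V → ℤ) (r : ℕ) : Prop :=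
  ∀ E : V → ℤ, Effective E → degD E = (r : ℤ) →
    ∃ D', LinEquiv G (D - E) D' ∧ Effective D'

/-- The `k`-gonality of a graph: the minimal degree of a divisor of rank at least `k`. -/
noncomputable def kGonality {V : Type*} [Fintype V] [DecidableEq V] (G : SimpleGraph V)
    [DecidableRel G.Adj] (k : ℕ) : ℕ :=
  sInf {d : ℕ | ∃ D : V → ℤ, RankGE G D k ∧ degD D = (d : ℤ)}

/-- The gonality of a graph: the minimal degree of a divisor of rank at least `1`. -/
noncomputable def gonality {V : Type*} [Fintype V] [DecidableEq V] (G : SimpleGraph V)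
    [DecidableRel G.Adj] : ℕ := kGonality G 1

/-- The two-dimensional rook graph `K_n □ K_m`: the box product of the complete graphs
on `n` and `m` vertices. -/
def rook (n m : ℕ) : SimpleGraph (Fin n × Fin m) :=
  (⊤ : SimpleGraph (Fin n)) □ (⊤ : SimpleGraph (Fin m))

instance (n m : ℕ) : DecidableRel (rook n m).Adj := by unfold rook; infer_instance

section RookLaplacian

variable {α β : Type*} [Fintype α] [Fintype β]

/-- The Laplacian of the box product of two complete graphs, in curried form. -/
def rookLap (g : α → β → ℤ) (i : α) (j : β) : ℤ :=
  ∑ i', (g i j - g i' j) + ∑ j', (g i j - g i j')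

open Classical in
/-- The integer-valued indicator function of a relation. -/
noncomputable def relInd (A : α → β → Prop) (i : α) (j : β) : ℤ := if A i j then 1 else 0

/-- The set `A` can be fired from the divisor `D` without putting a vertex of `A` in debt. -/
def LegalFiring (D : α → β → ℤ) (A : α → β → Prop) : Prop :=
  ∀ i j, A i j → rookLap (relInd A) i j ≤ D i j

omit [Fintype α] [Fintype β] in
theorem relInd_nonneg (A : α → β → Prop) (i : α) (j : β) : 0 ≤ relInd A i j := by
  unfold relInd; split_ifs <;> simp

omit [Fintype α] [Fintype β] in
theorem relInd_le_one (A : α → β → Prop) (i : α) (j : β) : relInd A i j ≤ 1 := by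
  unfold relInd; split_ifs <;> simp

omit [Fintype α] [Fintype β] in
theorem relInd_of_mem {A : α → β → Prop} {i : α} {j : β} (h : A i j) : relInd A i j = 1 :=
  if_pos h

omit [Fintype α] [Fintype β] in
theorem relInd_of_notMem {A : α → β → Prop} {i : α} {j : β} (h : ¬A i j) : relInd A i j = 0 :=
  if_neg h

theorem rookLap_flip (g : α → β → ℤ) (i : α) (j : β) :
    rookLap (fun j i => g i j) j i = rookLap g i j := add_comm _ _

theorem rookLap_add (f g : α → β → ℤ) (i : α) (j : β) :
    rookLap (fun i j => f i j + g i j) i j = rookLap f i j + rookLap g i j := by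
  simp only [rookLap, Finset.sum_sub_distrib, Finset.sum_add_distrib, Finset.sum_const]
  ring

theorem LegalFiring.flip {D : α → β → ℤ} {A : α → β → Prop} (h : LegalFiring D A) :
    LegalFiring (fun j i => D i j) (fun j i => A i j) := fun j i hA =>
  (rookLap_flip (relInd A) i j).trans_le (h i j hA)

theorem LegalFiring.mono {D D' : α → β → ℤ} {A : α → β → Prop} (h : LegalFiring D A)
    (hD : ∀ i j, D i j ≤ D' i j) : LegalFiring D' A := fun i j hA => (h i j hA).trans (hD i j)

theorem rookLap_relInd_of_mem {A : α → β → Prop} {i : α} {j : β} (h : A i j) :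
    rookLap (relInd A) i j = ∑ i', (1 - relInd A i' j) + ∑ j', (1 - relInd A i j') := by
  simp only [rookLap, relInd_of_mem h]

theorem rookLap_relInd_of_notMem {A : α → β → Prop} {i : α} {j : β} (h : ¬A i j) :
    rookLap (relInd A) i j = -(∑ i', relInd A i' j + ∑ j', relInd A i j') := by
  simp only [rookLap, relInd_of_notMem h, zero_sub, Finset.sum_neg_distrib]
  ring

omit [Fintype α] in
theorem sum_one_sub_relInd_nonneg (A : α → β → Prop) (i : α) :
    0 ≤ ∑ j, (1 - relInd A i j) :=
  Finset.sum_nonneg fun j _ => sub_nonneg.2 (relInd_le_one A i j)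

omit [Fintype α] in
theorem sum_one_sub_relInd_pos {A : α → β → Prop} {i : α} {j : β} (h : ¬A i j) :
    1 ≤ ∑ j, (1 - relInd A i j) := by
  have := Finset.single_le_sum (f := fun j => 1 - relInd A i j)
    (fun j _ => sub_nonneg.2 (relInd_le_one A i j)) (Finset.mem_univ j)
  simpa [relInd_of_notMem h] using this

omit [Fintype α] in
theorem sum_relInd_pos {A : α → β → Prop} {i : α} {j : β} (h : A i j) :
    1 ≤ ∑ j, relInd A i j := by
  have := Finset.single_le_sum (f := fun j => relInd A i j)
    (fun j _ => relInd_nonneg A i j) (Finset.mem_univ j)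
  simpa [relInd_of_mem h] using this

omit [Fintype α] in
/-- A proper nonempty part of a complete graph on `N` vertices has at least `N - 1` edges
leaving it. -/
theorem card_sub_one_le_cut {A : α → β → Prop} {i : α} {j k : β} (hj : A i j) (hk : ¬A i k) :
    (Fintype.card β : ℤ) - 1 ≤ (∑ j, relInd A i j) * ∑ j, (1 - relInd A i j) := by
  have h1 := sum_relInd_pos hj
  have h2 := sum_one_sub_relInd_pos hk
  have h3 : ∑ j, (1 - relInd A i j) = Fintype.card β - ∑ j, relInd A i j := by
    simp [Finset.sum_sub_distrib]
  rw [h3] at h2 ⊢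
  nlinarith

theorem LegalFiring.nonneg {D : α → β → ℤ} {A : α → β → Prop} (h : LegalFiring D A)
    {i : α} {j : β} (hA : A i j) : 0 ≤ D i j := by
  have := h i j hA
  rw [rookLap_relInd_of_mem hA] at this
  have h1 := sum_one_sub_relInd_nonneg A i
  have h2 := sum_one_sub_relInd_nonneg (fun j i => A i j) j
  simp only [relInd] at *
  linarith

theorem LegalFiring.row_outdegree_le {D : α → β → ℤ} {A : α → β → Prop} (h : LegalFiring D A)
    {i : α} {j : β} (hA : A i j) : ∑ j, (1 - relInd A i j) ≤ D i j := by
  have := h i j hA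
  rw [rookLap_relInd_of_mem hA] at this
  have h2 : 0 ≤ ∑ i', (1 - relInd A i' j) := sum_one_sub_relInd_nonneg (fun j i => A i j) j
  linarith

/-- A row with fewer than `card β - 1` chips, one of whose vertices is not fired, is not fired
at all. -/
theorem LegalFiring.row_empty {F : α → β → ℤ} {A : α → β → Prop} (h : LegalFiring F A)
    {i : α} {k : β} (hk : ¬A i k) (hF : ∑ j, max (F i j) 0 ≤ (Fintype.card β : ℤ) - 2) (j : β) :
    ¬A i j := by
  intro hj
  have h1 := card_sub_one_le_cut hj hk
  have h2 : (∑ j, relInd A i j) * ∑ j, (1 - relInd A i j) ≤ ∑ j, max (F i j) 0 := by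
    rw [Finset.sum_mul]
    refine Finset.sum_le_sum fun j _ => ?_
    by_cases hA : A i j
    · rw [relInd_of_mem hA, one_mul]
      exact (h.row_outdegree_le hA).trans (le_max_left _ _)
    · rw [relInd_of_notMem hA, zero_mul]
      exact le_max_right _ _
  linarith

theorem LegalFiring.effective {D : α → β → ℤ} {A : α → β → Prop} (h : LegalFiring D A)
    (hD : ∀ i j, 0 ≤ D i j) (i : α) (j : β) : 0 ≤ D i j - rookLap (relInd A) i j := by
  by_cases hA : A i j
  · exact sub_nonneg.2 (h i j hA)
  · rw [rookLap_relInd_of_notMem hA]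
    have h1 : 0 ≤ ∑ i', relInd A i' j := Finset.sum_nonneg fun i' _ => relInd_nonneg A i' j
    have h2 : 0 ≤ ∑ j', relInd A i j' := Finset.sum_nonneg fun j' _ => relInd_nonneg A i j'
    linarith [hD i j]

theorem sum_rookLap_row (g : α → β → ℤ) (i : α) :
    ∑ j, rookLap g i j = ∑ j, ∑ i', (g i j - g i' j) := by
  simp [rookLap, Finset.sum_add_distrib, Finset.sum_sub_distrib, Finset.mul_sum]

theorem sum_rookLap (g : α → β → ℤ) : ∑ i, ∑ j, rookLap g i j = 0 := by
  simp_rw [sum_rookLap_row]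
  rw [Finset.sum_comm]
  simp [Finset.sum_sub_distrib, Finset.mul_sum]

/-- Firing a set increases the number of chips in each row that it does not meet. -/
theorem lt_row_sum_of_row_empty (D : α → β → ℤ) {A : α → β → Prop} {i a : α} {b : β}
    (hi : ∀ j, ¬A i j) (hab : A a b) :
    ∑ j, D i j + 1 ≤ ∑ j, (D i j - rookLap (relInd A) i j) := by
  rw [Finset.sum_sub_distrib, sum_rookLap_row]
  have h1 : 1 ≤ ∑ j, ∑ i', relInd A i' j := by
    refine (sum_relInd_pos (A := fun j i => A i j) hab).trans ?_
    exact Finset.single_le_sum (f := fun j => ∑ i', relInd A i' j)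
      (fun j _ => Finset.sum_nonneg fun i' _ => relInd_nonneg A i' j) (Finset.mem_univ b)
  have h2 : ∑ j, ∑ i', (relInd A i j - relInd A i' j) = -∑ j, ∑ i', relInd A i' j := by
    simp [relInd_of_notMem (hi _)]
  linarith

theorem LegalFiring.le_row_sum {D : α → β → ℤ} {A : α → β → Prop} (h : LegalFiring D A)
    (hD : ∀ i j, 0 ≤ D i j) {i : α} {j k : β} (hj : A i j) (hk : ¬A i k) :
    (Fintype.card β : ℤ) - 1 ≤ ∑ j, (D i j - rookLap (relInd A) i j) := by
  refine (card_sub_one_le_cut hj hk).trans ?_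
  rw [mul_comm, Finset.sum_mul]
  refine Finset.sum_le_sum fun j _ => ?_
  by_cases hA : A i j
  · simpa [relInd_of_mem hA] using h i j hA
  · rw [relInd_of_notMem hA, rookLap_relInd_of_notMem hA]
    have h1 : 0 ≤ ∑ i', relInd A i' j := Finset.sum_nonneg fun i' _ => relInd_nonneg A i' j
    linarith [hD i j]

/-- Firing a set that contains no full row does not decrease the truncated row sums. -/
theorem LegalFiring.min_row_sum_le {D : α → β → ℤ} {A : α → β → Prop} (h : LegalFiring D A)
    (hD : ∀ i j, 0 ≤ D i j) {a : α} {b : β} (hab : A a b) {c : β} (i : α) (hc : ¬A i c) :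
    min (∑ j, D i j) (Fintype.card β - 1) ≤
      min (∑ j, (D i j - rookLap (relInd A) i j)) (Fintype.card β - 1) := by
  by_cases hi : ∀ j, ¬A i j
  · have := lt_row_sum_of_row_empty D hi hab
    exact min_le_min_right _ (by linarith)
  · push Not at hi
    obtain ⟨j, hj⟩ := hi
    have := h.le_row_sum hD hj hc
    exact (min_le_right _ _).trans (le_min this le_rfl)

/-- If `F` is equivalent to an effective divisor, then some nonempty set can be fired
legally from `F`. -/
theorem exists_legalFiring [Nonempty α] [Nonempty β] {F g : α → β → ℤ}
    (h : ∀ i j, 0 ≤ F i j - rookLap g i j) : ∃ A : α → β → Prop, (∃ i j, A i j) ∧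
      LegalFiring F A := by
  refine ⟨fun i j => ∀ i' j', g i' j' ≤ g i j, ?_, ?_⟩
  · obtain ⟨⟨i, j⟩, hij⟩ := Finite.exists_max fun p : α × β => g p.1 p.2
    exact ⟨i, j, fun i' j' => hij (i', j')⟩
  · intro i j hA
    have key : ∀ i' j', 1 - relInd (fun i j => ∀ i' j', g i' j' ≤ g i j) i' j' ≤
        g i j - g i' j' := by
      intro i' j'
      by_cases hB : ∀ x y, g x y ≤ g i' j'
      · rw [relInd_of_mem hB]
        linarith [hA i' j']
      · rw [relInd_of_notMem hB]
        push Not at hB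
        obtain ⟨x, y, hxy⟩ := hB
        linarith [hA x y]
    rw [rookLap_relInd_of_mem hA]
    have h1 : rookLap g i j ≤ F i j := sub_nonneg.1 (h i j)
    refine le_trans (add_le_add ?_ ?_) h1
    · exact Finset.sum_le_sum fun i' _ => key i' j
    · exact Finset.sum_le_sum fun j' _ => key i j'

/-- Removing a chip from a pile lowers the number of chips outside debt. -/
theorem sum_max_sub_le {D E : β → ℤ} (hD : ∀ j, 0 ≤ D j) (hE : ∀ j, 0 ≤ E j) {k : ℤ} {x : β}
    (hs : ∑ j, D j ≤ k + 1) (hx : (1 ≤ D x ∧ 1 ≤ E x) ∨ ∑ j, D j ≤ k) :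
    ∑ j, max (D j - E j) 0 ≤ k := by
  have hle : ∀ j, max (D j - E j) 0 ≤ D j := fun j =>
    max_le (by linarith [hE j]) (hD j)
  rcases hx with ⟨h1, h2⟩ | hx
  · have : ∑ j, max (D j - E j) 0 < ∑ j, D j :=
      Finset.sum_lt_sum (fun j _ => hle j) ⟨x, Finset.mem_univ x, by
        rw [max_lt_iff]; constructor <;> linarith⟩
    linarith
  · exact (Finset.sum_le_sum fun j _ => hle j).trans hx

theorem exists_pos_or_sum_le [Nonempty β] (D : β → ℤ) {k : ℤ} (hk : 0 ≤ k) :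
    ∃ x, 1 ≤ D x ∨ ∑ j, D j ≤ k := by
  by_contra! h
  have h1 : ∑ j, D j ≤ 0 := Finset.sum_nonpos fun j _ => by linarith [(h j).1]
  linarith [(h (Classical.arbitrary β)).2]

/-- If every row has at least `card β - 1` chips and the total is less than
`card α * card β`, then a legally fired set without full lines meets only one column. -/
theorem LegalFiring.col_unique {D : α → β → ℤ} {A : α → β → Prop} (h : LegalFiring D A)
    (hD : ∀ i j, 0 ≤ D i j) (hrow : ∀ i, ∃ j, ¬A i j) (hcol : ∀ j, ∃ i, ¬A i j)
    (hs : ∀ i, (Fintype.card β : ℤ) - 1 ≤ ∑ j, D i j) (hα : 2 ≤ Fintype.card α)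
    (hdeg : ∑ i, ∑ j, D i j ≤ (Fintype.card α : ℤ) * Fintype.card β - 1)
    {i i' : α} {j j' : β} (hA : A i j) (hA' : A i' j') : j = j' := by
  classical
  by_contra hne
  let c : β → ℤ := fun j => ∑ i, (1 - relInd A i j)
  have hc : ∀ j, 0 ≤ c j := fun j => sum_one_sub_relInd_nonneg (fun j i => A i j) j
  have hr : ∀ i, (Fintype.card β : ℤ) - 1 + ∑ j, relInd A i j * c j ≤ ∑ j, D i j := by
    intro i
    by_cases hi : ∃ j, A i j
    · obtain ⟨j, hj⟩ := hi
      obtain ⟨k, hk⟩ := hrow i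
      refine (add_le_add_left (card_sub_one_le_cut hj hk) _).trans ?_
      rw [Finset.sum_mul, ← Finset.sum_add_distrib]
      refine Finset.sum_le_sum fun j _ => ?_
      by_cases hA : A i j
      · have := h i j hA
        rw [rookLap_relInd_of_mem hA] at this
        simp only [relInd_of_mem hA, one_mul, c]
        linarith
      · simp [relInd_of_notMem hA, hD i j]
    · push Not at hi
      simpa [relInd_of_notMem (hi _)] using hs i
  have htot : (Fintype.card α : ℤ) * (Fintype.card β - 1) +
      ∑ j, (∑ i, relInd A i j) * c j ≤ ∑ i, ∑ j, D i j := by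
    refine le_trans (le_of_eq ?_) (Finset.sum_le_sum fun i _ => hr i)
    rw [Finset.sum_add_distrib, Finset.sum_comm (f := fun i j => relInd A i j * c j)]
    simp [Finset.sum_mul, mul_sub]
  have hcut : ∀ {i j}, A i j → (Fintype.card α : ℤ) - 1 ≤ (∑ i, relInd A i j) * c j := by
    intro i j hij
    obtain ⟨k, hk⟩ := hcol j
    exact card_sub_one_le_cut (A := fun j i => A i j) hij hk
  have hpair : (∑ i, relInd A i j) * c j + (∑ i, relInd A i j') * c j' ≤
      ∑ j, (∑ i, relInd A i j) * c j := by
    rw [← Finset.sum_pair (f := fun j => (∑ i, relInd A i j) * c j) hne]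
    exact Finset.sum_le_sum_of_subset_of_nonneg (Finset.subset_univ _) fun j _ _ =>
      mul_nonneg (Finset.sum_nonneg fun i _ => relInd_nonneg A i j) (hc j)
  have h1 := hcut hA
  have h2 := hcut hA'
  have h3 : (2 : ℤ) ≤ Fintype.card α := by exact_mod_cast hα
  linarith

/-- The effective divisor with one chip at `(a, b)`. -/
def chipAt [DecidableEq α] [DecidableEq β] (a : α) (b : β) (i : α) (j : β) : ℤ :=
  if i = a ∧ j = b then 1 else 0

omit [Fintype α] [Fintype β] in
theorem chipAt_nonneg [DecidableEq α] [DecidableEq β] (a : α) (b : β) (i : α) (j : β) :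
    0 ≤ chipAt a b i j := by
  unfold chipAt; split_ifs <;> simp

omit [Fintype α] [Fintype β] in
theorem chipAt_self [DecidableEq α] [DecidableEq β] (a : α) (b : β) : chipAt a b a b = 1 := by
  simp [chipAt]

theorem sum_chipAt [DecidableEq α] [DecidableEq β] (a : α) (b : β) :
    ∑ i, ∑ j, chipAt a b i j = 1 := by
  simp [chipAt, ite_and]

/-- Rank at least three, expressed through the Laplacian. -/
def RookRankGEThree (D : α → β → ℤ) : Prop :=
  ∀ E : α → β → ℤ, (∀ i j, 0 ≤ E i j) → ∑ i, ∑ j, E i j = 3 →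
    ∃ g : α → β → ℤ, ∀ i j, 0 ≤ D i j - E i j - rookLap g i j

theorem RookRankGEThree.sub_rookLap {D : α → β → ℤ} (h : RookRankGEThree D) (f : α → β → ℤ) :
    RookRankGEThree fun i j => D i j - rookLap f i j := by
  intro E hE hE3
  obtain ⟨g, hg⟩ := h E hE hE3
  refine ⟨fun i j => g i j + (-1) * f i j, fun i j => ?_⟩
  have : rookLap (fun i j => (-1) * f i j) i j = - rookLap f i j := by
    simp [rookLap, Finset.sum_add_distrib]
    ring
  rw [rookLap_add, this]
  linarith [hg i j]

/-- Removing three chips leaves a nonempty legally fired set. -/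
theorem RookRankGEThree.exists_legalFiring [DecidableEq α] [DecidableEq β] {D : α → β → ℤ}
    (h : RookRankGEThree D) (a₁ a₂ a₃ : α) (b₁ b₂ b₃ : β) :
    ∃ A : α → β → Prop, (∃ i j, A i j) ∧ LegalFiring (fun i j => D i j -
      (chipAt a₁ b₁ i j + chipAt a₂ b₂ i j + chipAt a₃ b₃ i j)) A := by
  have : Nonempty α := ⟨a₁⟩
  have : Nonempty β := ⟨b₁⟩
  obtain ⟨g, hg⟩ := h (fun i j => chipAt a₁ b₁ i j + chipAt a₂ b₂ i j + chipAt a₃ b₃ i j)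
    (fun i j => by linarith [chipAt_nonneg a₁ b₁ i j, chipAt_nonneg a₂ b₂ i j,
      chipAt_nonneg a₃ b₃ i j]) (by simp [Finset.sum_add_distrib, sum_chipAt])
  exact _root_.exists_legalFiring hg

/-- From an effective divisor of rank at least three one can legally fire a nonempty set that
avoids a given poor row and a given poor column. -/
theorem RookRankGEThree.exists_legalFiring_avoiding {D : α → β → ℤ} (h : RookRankGEThree D)
    (hD : ∀ i j, 0 ≤ D i j) (hα : 2 ≤ Fintype.card α) (hβ : 2 ≤ Fintype.card β) {r : α} {c : β}
    (hr : ∑ j, D r j ≤ (Fintype.card β : ℤ) - 1) (hc : ∑ i, D i c ≤ (Fintype.card α : ℤ) - 1) :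
    ∃ A : α → β → Prop, (∃ i j, A i j) ∧ LegalFiring D A ∧ (∀ j, ¬A r j) ∧ ∀ i, ¬A i c := by
  classical
  have : Nonempty α := ⟨r⟩
  have : Nonempty β := ⟨c⟩
  have hα' : (2 : ℤ) ≤ Fintype.card α := by exact_mod_cast hα
  have hβ' : (2 : ℤ) ≤ Fintype.card β := by exact_mod_cast hβ
  obtain ⟨q, hq⟩ : ∃ q, D r q ≤ 0 := by
    by_contra! hpos
    have : ∑ _j : β, (1 : ℤ) ≤ ∑ j, D r j := Finset.sum_le_sum fun j _ => hpos j
    simp at this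
    linarith
  obtain ⟨x, hx⟩ := exists_pos_or_sum_le (D r) (sub_nonneg.2 hβ')
  obtain ⟨y, hy⟩ := exists_pos_or_sum_le (fun i => D i c) (sub_nonneg.2 hα')
  obtain ⟨A, hne, hA⟩ := h.exists_legalFiring r r y q x c
  have hnn := fun i j => chipAt_nonneg r q i j
  have hnn' := fun i j => chipAt_nonneg r x i j
  have hnn'' := fun i j => chipAt_nonneg y c i j
  have hE : ∀ i j, 0 ≤ chipAt r q i j + chipAt r x i j + chipAt y c i j := fun i j => by
    linarith [hnn i j, hnn' i j, hnn'' i j]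
  have hqA : ¬A r q := fun hmem => by
    have := hA.nonneg hmem
    linarith [chipAt_self r q, hnn' r q, hnn'' r q]
  have hrow : ∀ j, ¬A r j := hA.row_empty hqA <| by
    refine sum_max_sub_le (hD r) (hE r) (x := x) (by linarith) (hx.imp_left fun hx => ⟨hx, ?_⟩)
    linarith [chipAt_self r x, hnn r x, hnn'' r x]
  refine ⟨A, hne, hA.mono fun i j => by linarith [hE i j], hrow, ?_⟩
  refine hA.flip.row_empty (hrow c) ?_
  refine sum_max_sub_le (fun i => hD i c) (fun i => hE i c) (x := y) (by linarith)
    (hy.imp_left fun hy => ⟨hy, ?_⟩)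
  linarith [chipAt_self y c, hnn y c, hnn' y c]

/-- The number of chips in the rows and columns, each row counted up to one less than its
length, and each column likewise. -/
def truncatedLineSum (D : α → β → ℤ) : ℤ :=
  ∑ i, min (∑ j, D i j) (Fintype.card β - 1) + ∑ j, min (∑ i, D i j) (Fintype.card α - 1)

theorem truncatedLineSum_le (D : α → β → ℤ) : truncatedLineSum D ≤
    Fintype.card α * ((Fintype.card β : ℤ) - 1) + Fintype.card β * ((Fintype.card α : ℤ) - 1) := by
  refine add_le_add ((Finset.sum_le_sum fun i _ => min_le_right _ _).trans ?_)
    ((Finset.sum_le_sum fun i _ => min_le_right _ _).trans ?_) <;> simp [mul_sub]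

/-- Legally firing a set that avoids a row and a column increases the truncated line sums,
unless that row and column already have as many chips as are counted. -/
theorem LegalFiring.truncatedLineSum_lt {D : α → β → ℤ} {A : α → β → Prop} (h : LegalFiring D A)
    (hD : ∀ i j, 0 ≤ D i j) {a r : α} {b c : β} (hab : A a b) (hr : ∀ j, ¬A r j)
    (hc : ∀ i, ¬A i c)
    (hlt : ∑ j, D r j < (Fintype.card β : ℤ) - 1 ∨ ∑ i, D i c < (Fintype.card α : ℤ) - 1) :
    truncatedLineSum D < truncatedLineSum fun i j => D i j - rookLap (relInd A) i j := by
  have hrows := fun i => h.min_row_sum_le hD hab i (hc i)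
  have hcols := fun j => h.flip.min_row_sum_le (fun j i => hD i j) hab j (hr j)
  have hflip : ∀ i j, rookLap (relInd fun j i => A i j) j i = rookLap (relInd A) i j :=
    fun i j => rookLap_flip (relInd A) i j
  simp only [hflip] at hcols
  have hR := lt_row_sum_of_row_empty D hr hab
  have hC := lt_row_sum_of_row_empty (fun j i => D i j) (A := fun j i => A i j) hc hab
  simp only [hflip] at hC
  rcases hlt with hlt | hlt
  · refine add_lt_add_of_lt_of_le (Finset.sum_lt_sum (fun i _ => hrows i)
      ⟨r, Finset.mem_univ r, ?_⟩) (Finset.sum_le_sum fun j _ => hcols j)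
    rw [min_eq_left hlt.le]
    exact lt_min (by linarith) hlt
  · refine add_lt_add_of_le_of_lt (Finset.sum_le_sum fun i _ => hrows i)
      (Finset.sum_lt_sum (fun j _ => hcols j) ⟨c, Finset.mem_univ c, ?_⟩)
    rw [min_eq_left hlt.le]
    exact lt_min (by linarith) hlt

theorem exists_row_sum_le [Nonempty α] {D : α → β → ℤ}
    (hdeg : ∑ i, ∑ j, D i j ≤ (Fintype.card α : ℤ) * Fintype.card β - 1) :
    ∃ r, ∑ j, D r j ≤ (Fintype.card β : ℤ) - 1 := by
  by_contra! h
  have : ∑ _i : α, (Fintype.card β : ℤ) ≤ ∑ i, ∑ j, D i j :=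
    Finset.sum_le_sum fun i _ => by linarith [h i]
  simp at this
  linarith

theorem RookRankGEThree.exists_effective [Nonempty α] [Nonempty β] {D : α → β → ℤ}
    (h : RookRankGEThree D) : ∃ g : α → β → ℤ, ∀ i j, 0 ≤ D i j - rookLap g i j := by
  classical
  let a := Classical.arbitrary α
  let b := Classical.arbitrary β
  obtain ⟨g, hg⟩ := h (fun i j => 3 * chipAt a b i j)
    (fun i j => by linarith [chipAt_nonneg a b i j])
    (by simp [← Finset.mul_sum, sum_chipAt])
  exact ⟨g, fun i j => by linarith [hg i j, chipAt_nonneg a b i j]⟩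

/-- A divisor of rank at least three and degree less than `card α * card β` is equivalent to an
effective one in which no line is short of more than one chip. -/
theorem RookRankGEThree.exists_balanced {D : α → β → ℤ} (h : RookRankGEThree D)
    (hα : 2 ≤ Fintype.card α) (hβ : 2 ≤ Fintype.card β)
    (hdeg : ∑ i, ∑ j, D i j ≤ (Fintype.card α : ℤ) * Fintype.card β - 1) :
    ∃ D' : α → β → ℤ, RookRankGEThree D' ∧ (∀ i j, 0 ≤ D' i j) ∧
      ∑ i, ∑ j, D' i j ≤ (Fintype.card α : ℤ) * Fintype.card β - 1 ∧
      (∀ i, (Fintype.card β : ℤ) - 1 ≤ ∑ j, D' i j) ∧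
      ∀ j, (Fintype.card α : ℤ) - 1 ≤ ∑ i, D' i j := by
  have : Nonempty α := Fintype.card_pos_iff.1 (by omega)
  have : Nonempty β := Fintype.card_pos_iff.1 (by omega)
  obtain ⟨_, ⟨D', hrk, heff, hdeg', rfl⟩, hmax⟩ := Int.exists_greatest_of_bdd
    (P := fun z => ∃ D' : α → β → ℤ, RookRankGEThree D' ∧ (∀ i j, 0 ≤ D' i j) ∧
      ∑ i, ∑ j, D' i j ≤ (Fintype.card α : ℤ) * Fintype.card β - 1 ∧ truncatedLineSum D' = z)
    ⟨_, by rintro z ⟨D', -, -, -, rfl⟩; exact truncatedLineSum_le D'⟩ (by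
      obtain ⟨g, hg⟩ := h.exists_effective
      exact ⟨_, _, h.sub_rookLap g, hg, by
        simpa [Finset.sum_sub_distrib, sum_rookLap] using hdeg, rfl⟩)
  have key : ∀ r c, ∑ j, D' r j ≤ (Fintype.card β : ℤ) - 1 →
      ∑ i, D' i c ≤ (Fintype.card α : ℤ) - 1 →
      ¬(∑ j, D' r j < (Fintype.card β : ℤ) - 1 ∨ ∑ i, D' i c < (Fintype.card α : ℤ) - 1) := by
    intro r c hr hc hlt
    obtain ⟨A, ⟨a, b, hab⟩, hA, hAr, hAc⟩ := hrk.exists_legalFiring_avoiding heff hα hβ hr hc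
    refine (hA.truncatedLineSum_lt heff hab hAr hAc hlt).not_ge (hmax _
      ⟨_, hrk.sub_rookLap (relInd A), hA.effective heff, ?_, rfl⟩)
    simpa [Finset.sum_sub_distrib, sum_rookLap] using hdeg'
  obtain ⟨r, hr⟩ := exists_row_sum_le hdeg'
  obtain ⟨c, hc⟩ := exists_row_sum_le (D := fun j i => D' i j) (by
    rw [Finset.sum_comm, mul_comm]; exact hdeg')
  refine ⟨D', hrk, heff, hdeg', fun i => ?_, fun j => ?_⟩
  · by_contra! hlt
    exact key i c hlt.le hc (Or.inl hlt)
  · by_contra! hlt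
    exact key r j hr hlt.le (Or.inr hlt)

/-- In a balanced divisor, a legally fired set without full lines is a single vertex. -/
theorem LegalFiring.exists_eq_singleton {D : α → β → ℤ} {A : α → β → Prop} (h : LegalFiring D A)
    (hD : ∀ i j, 0 ≤ D i j) (hrow : ∀ i, ∃ j, ¬A i j) (hcol : ∀ j, ∃ i, ¬A i j)
    (hs : ∀ i, (Fintype.card β : ℤ) - 1 ≤ ∑ j, D i j)
    (ht : ∀ j, (Fintype.card α : ℤ) - 1 ≤ ∑ i, D i j)
    (hα : 2 ≤ Fintype.card α) (hβ : 2 ≤ Fintype.card β)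
    (hdeg : ∑ i, ∑ j, D i j ≤ (Fintype.card α : ℤ) * Fintype.card β - 1)
    {a : α} {b : β} (hab : A a b) (i : α) (j : β) : A i j ↔ i = a ∧ j = b := by
  refine ⟨fun hij => ⟨?_, h.col_unique hD hrow hcol hs hα hdeg hij hab⟩, ?_⟩
  · refine h.flip.col_unique (fun j i => hD i j) hcol hrow ht hβ ?_ hij hab
    rw [Finset.sum_comm, mul_comm]
    exact hdeg
  · rintro ⟨rfl, rfl⟩
    exact hab

theorem rookLap_relInd_singleton {A : α → β → Prop} {a : α} {b : β}
    (h : ∀ i j, A i j ↔ i = a ∧ j = b) :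
    rookLap (relInd A) a b = (Fintype.card α : ℤ) - 1 + (Fintype.card β - 1) := by
  classical
  rw [rookLap_relInd_of_mem ((h a b).2 ⟨rfl, rfl⟩)]
  simp [relInd, h]

/-- A vertex able to fire from a balanced divisor holds all the chips of its row, and the other
rows are one chip short. -/
theorem row_eq_zero_of_balanced {D : α → β → ℤ} (hD : ∀ i j, 0 ≤ D i j)
    (hs : ∀ i, (Fintype.card β : ℤ) - 1 ≤ ∑ j, D i j)
    (hdeg : ∑ i, ∑ j, D i j ≤ (Fintype.card α : ℤ) * Fintype.card β - 1) {a : α} {b : β}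
    (hab : (Fintype.card α : ℤ) - 1 + (Fintype.card β - 1) ≤ D a b) :
    (∀ j, j ≠ b → D a j = 0) ∧ ∀ i, i ≠ a → ∑ j, D i j = (Fintype.card β : ℤ) - 1 := by
  classical
  have hrow : ∑ i, (∑ j, D i j - ((Fintype.card β : ℤ) - 1)) ≤ Fintype.card α - 1 := by
    simp only [Finset.sum_sub_distrib, Finset.sum_const, Finset.card_univ, nsmul_eq_mul]
    linarith
  constructor
  · intro j hj
    have h1 : D a j + D a b ≤ ∑ j, D a j := by
      rw [← Finset.sum_pair hj]
      exact Finset.sum_le_sum_of_subset_of_nonneg (Finset.subset_univ _) fun j _ _ => hD a j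
    have h2 := Finset.single_le_sum (f := fun i => ∑ j, D i j - ((Fintype.card β : ℤ) - 1))
      (fun i _ => sub_nonneg.2 (hs i)) (Finset.mem_univ a)
    linarith [hD a j]
  · intro i hi
    have h1 : D a b ≤ ∑ j, D a j :=
      Finset.single_le_sum (fun j _ => hD a j) (Finset.mem_univ b)
    have h2 : (∑ j, D i j - ((Fintype.card β : ℤ) - 1)) +
        (∑ j, D a j - ((Fintype.card β : ℤ) - 1)) ≤
        ∑ i, (∑ j, D i j - ((Fintype.card β : ℤ) - 1)) := by
      rw [← Finset.sum_pair (f := fun i => ∑ j, D i j - ((Fintype.card β : ℤ) - 1)) hi]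
      exact Finset.sum_le_sum_of_subset_of_nonneg (Finset.subset_univ _) fun i _ _ =>
        sub_nonneg.2 (hs i)
    linarith [hs i]

theorem RookRankGEThree.card_mul_card_le {D : α → β → ℤ} (h : RookRankGEThree D)
    (hα : 2 ≤ Fintype.card α) (hβ : 2 ≤ Fintype.card β) :
    (Fintype.card α : ℤ) * Fintype.card β ≤ ∑ i, ∑ j, D i j := by
  classical
  by_contra! hlt
  obtain ⟨D, h, hD, hdeg, hs, ht⟩ := h.exists_balanced hα hβ (Int.le_sub_one_of_lt hlt)
  have hα' : (2 : ℤ) ≤ Fintype.card α := by exact_mod_cast hα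
  have hβ' : (2 : ℤ) ≤ Fintype.card β := by exact_mod_cast hβ
  have : Nontrivial α := Fintype.one_lt_card_iff_nontrivial.1 hα
  have : Nontrivial β := Fintype.one_lt_card_iff_nontrivial.1 hβ
  have hdeg' : ∑ j, ∑ i, D i j ≤ (Fintype.card β : ℤ) * Fintype.card α - 1 := by
    rw [Finset.sum_comm, mul_comm]; exact hdeg
  obtain ⟨r, hr⟩ := exists_row_sum_le hdeg
  obtain ⟨c, hc⟩ := exists_row_sum_le (D := fun j i => D i j) hdeg'
  obtain ⟨A, ⟨a, b, hab⟩, hA, hAr, hAc⟩ := h.exists_legalFiring_avoiding hD hα hβ hr hc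
  have hsing := hA.exists_eq_singleton hD (fun i => ⟨c, hAc i⟩) (fun j => ⟨r, hAr j⟩) hs ht
    hα hβ hdeg hab
  have hDab := hA a b hab
  rw [rookLap_relInd_singleton hsing] at hDab
  obtain ⟨hrow0, hrows⟩ := row_eq_zero_of_balanced hD hs hdeg hDab
  obtain ⟨hcol0, hcols⟩ := row_eq_zero_of_balanced (fun j i => hD i j) ht hdeg'
    (by linarith : _ ≤ D a b)
  obtain ⟨k, hk⟩ := exists_ne b
  obtain ⟨x, hx⟩ := exists_pos_or_sum_le (fun i => D i k) (sub_nonneg.2 hα')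
  obtain ⟨B, ⟨a', b', hab'⟩, hB⟩ := h.exists_legalFiring a a x k b k
  have hnn := fun i j => chipAt_nonneg a k i j
  have hnn' := fun i j => chipAt_nonneg a b i j
  have hnn'' := fun i j => chipAt_nonneg x k i j
  have hE : ∀ i j, 0 ≤ chipAt a k i j + chipAt a b i j + chipAt x k i j := fun i j => by
    linarith [hnn i j, hnn' i j, hnn'' i j]
  have hBak : ¬B a k := fun hmem => by
    have := hB.nonneg hmem
    linarith [chipAt_self a k, hnn' a k, hnn'' a k, hrow0 k hk]
  have hBk : ∀ i, ¬B i k := hB.flip.row_empty hBak <| by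
    refine sum_max_sub_le (fun i => hD i k) (fun i => hE i k) (x := x)
      (by linarith [hcols k hk]) (hx.imp_left fun hx => ⟨hx, ?_⟩)
    linarith [chipAt_self x k, hnn x k, hnn' x k]
  have hBa : ∀ j, j ≠ b → ¬B a j := fun j hj hmem => by
    have h1 := hB.row_outdegree_le hmem
    have h2 := sum_one_sub_relInd_pos (hBk a)
    linarith [hrow0 j hj, hE a j]
  have hBb : ∀ i, i ≠ a → ¬B i b := fun i hi hmem => by
    have h1 := hB.row_outdegree_le hmem
    have h2 := sum_one_sub_relInd_pos (hBk i)
    linarith [hcol0 i hi, hE i b]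
  obtain ⟨l, hl⟩ := exists_ne a
  have hBD : LegalFiring D B := hB.mono fun i j => by linarith [hE i j]
  have hsing' := hBD.exists_eq_singleton hD (fun i => ⟨k, hBk i⟩) (fun j => by
    by_cases hj : j = b
    · exact ⟨l, hj ▸ hBb l hl⟩
    · exact ⟨a, hBa j hj⟩) hs ht hα hβ hdeg hab'
  have hle := hB a' b' hab'
  rw [rookLap_relInd_singleton hsing'] at hle
  by_cases ha : a' = a
  · subst ha
    by_cases hb : b' = b
    · subst hb
      have hsum : D a' b' ≤ ∑ j, D a' j :=
        Finset.single_le_sum (fun j _ => hD a' j) (Finset.mem_univ b')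
      have hrest : ((Fintype.card α : ℤ) - 1) * (Fintype.card β - 1) ≤
          ∑ i ∈ Finset.univ.erase a', ∑ j, D i j := by
        have := Finset.card_nsmul_le_sum (Finset.univ.erase a') (fun i => ∑ j, D i j)
          ((Fintype.card β : ℤ) - 1) fun i _ => hs i
        rw [Finset.card_erase_of_mem (Finset.mem_univ a'), Finset.card_univ, nsmul_eq_mul,
          Nat.cast_sub (by omega), Nat.cast_one] at this
        exact this
      have htot := Finset.add_sum_erase Finset.univ (fun i => ∑ j, D i j) (Finset.mem_univ a')
      nlinarith [chipAt_self a' b', hnn a' b', hnn'' a' b']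
    · exact hBa b' hb hab'
  · have hsum : D a' b' ≤ ∑ j, D a' j :=
      Finset.single_le_sum (fun j _ => hD a' j) (Finset.mem_univ b')
    linarith [hrows a' ha, hE a' b']

end RookLaplacian

theorem edgesTo_rook {n m : ℕ} (v : Fin n × Fin m) (B : Finset (Fin n × Fin m)) (hv : v ∉ B) :
    (edgesTo (rook n m) v B : ℤ) =
      ∑ i, (if (i, v.2) ∈ B then 1 else 0) + ∑ j, (if (v.1, j) ∈ B then 1 else 0) := by
  obtain ⟨a, b⟩ := v
  have hcard : (edgesTo (rook n m) (a, b) B : ℤ) =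
      ∑ i, ∑ j, if (i, j) ∈ B ∧ (rook n m).Adj (a, b) (i, j) then (1 : ℤ) else 0 := by
    rw [edgesTo, Finset.card_filter, Nat.cast_sum, ← Fintype.sum_prod_type',
      ← Finset.sum_filter_add_sum_filter_not Finset.univ (· ∈ B)]
    simp [ite_and]
  have hsplit : ∀ i j, (if (i, j) ∈ B ∧ (rook n m).Adj (a, b) (i, j) then (1 : ℤ) else 0) =
      (if j = b then (if (i, b) ∈ B then 1 else 0) else 0) +
      (if i = a then (if (a, j) ∈ B then 1 else 0) else 0) := by
    intro i j
    by_cases hi : i = a <;> by_cases hj : j = b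
    · subst hi hj; simp [hv]
    · subst hi; simp [rook, hj, Ne.symm hj]
    · subst hj; simp [rook, hi, Ne.symm hi]
    · simp [rook, hi, hj, Ne.symm hi, Ne.symm hj]
  rw [hcard]
  simp_rw [hsplit, Finset.sum_add_distrib]
  simp

theorem fire_rook {n m : ℕ} (D : Fin n × Fin m → ℤ) (A : Finset (Fin n × Fin m))
    (v : Fin n × Fin m) : fire (rook n m) D A v =
      D v - rookLap (relInd fun i j => (i, j) ∈ A) v.1 v.2 := by
  unfold fire
  split_ifs with hv
  · rw [edgesTo_rook v _ (by simpa using hv), rookLap_relInd_of_mem (A := fun i j => (i, j) ∈ A) hv]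
    congr 2 <;> refine Finset.sum_congr rfl fun x _ => ?_ <;>
      simp only [relInd, Finset.mem_compl] <;> split_ifs <;> simp_all
  · rw [edgesTo_rook v _ hv, rookLap_relInd_of_notMem (A := fun i j => (i, j) ∈ A) hv, sub_neg_eq_add]
    simp only [relInd]
    congr!

theorem LinEquiv.exists_rookLap {n m : ℕ} {D D' : Fin n × Fin m → ℤ}
    (h : LinEquiv (rook n m) D D') :
    ∃ g : Fin n → Fin m → ℤ, ∀ v, D' v = D v - rookLap g v.1 v.2 := by
  induction h with
  | refl => exact ⟨fun _ _ => 0, fun v => by simp [rookLap]⟩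
  | tail _ hstep ih =>
    obtain ⟨g, hg⟩ := ih
    obtain ⟨A, rfl⟩ := hstep
    refine ⟨fun i j => g i j + relInd (fun i j => (i, j) ∈ A) i j, fun v => ?_⟩
    rw [fire_rook, hg, rookLap_add]
    ring

theorem RankGE.rookRankGEThree {n m : ℕ} {D : Fin n × Fin m → ℤ} (h : RankGE (rook n m) D 3) :
    RookRankGEThree fun i j => D (i, j) := by
  intro E hE hE3
  obtain ⟨D', hD', heff⟩ := h (fun v => E v.1 v.2) (fun v => hE v.1 v.2) (by
    rw [degD, Fintype.sum_prod_type]; exact_mod_cast hE3)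
  obtain ⟨g, hg⟩ := hD'.exists_rookLap
  refine ⟨g, fun i j => ?_⟩
  have := hg (i, j)
  simp only [Pi.sub_apply] at this
  linarith [heff (i, j)]

theorem fire_rook_compl {n m : ℕ} (D : Fin n × Fin m → ℤ) (B : Finset (Fin n × Fin m))
    (v : Fin n × Fin m) : fire (rook n m) D Bᶜ v =
      D v + rookLap (relInd fun i j => (i, j) ∈ B) v.1 v.2 := by
  have h : ∀ i j, relInd (fun i j => (i, j) ∈ Bᶜ) i j =
      1 - relInd (fun i j => (i, j) ∈ B) i j := by
    intro i j
    by_cases hB : (i, j) ∈ B <;> simp [relInd, hB]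
  rw [fire_rook]
  simp only [rookLap, h, sub_sub_sub_cancel_left, Finset.sum_sub_distrib]
  ring

/-- A divisor of degree three removed from the all-ones divisor leaves a divisor that is
effective after at most one firing. -/
theorem rankGE_three_one {n m : ℕ} (hn : 2 ≤ n) (hm : 2 ≤ m) :
    RankGE (rook n m) (fun _ => 1) 3 := by
  intro E hE hE3
  have hpair : ∀ {x y}, x ≠ y → E x + E y ≤ 3 := by
    intro x y hxy
    rw [← Finset.sum_pair hxy]
    exact (Finset.sum_le_sum_of_subset_of_nonneg (Finset.subset_univ _) fun u _ _ => hE u).trans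
      hE3.le
  have htriple : ∀ {x y z}, x ≠ y → x ≠ z → y ≠ z → E x + E y + E z ≤ 3 := by
    intro x y z hxy hxz hyz
    rw [add_assoc, ← Finset.sum_pair hyz, ← Finset.sum_insert (by simp [hxy, hxz])]
    exact (Finset.sum_le_sum_of_subset_of_nonneg (Finset.subset_univ _) fun u _ _ => hE u).trans
      hE3.le
  have hle : ∀ x, E x ≤ 3 := fun x =>
    (Finset.single_le_sum (fun u _ => hE u) (Finset.mem_univ x)).trans hE3.le
  have hn' : (2 : ℤ) ≤ n := by exact_mod_cast hn
  have hm' : (2 : ℤ) ≤ m := by exact_mod_cast hm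
  by_cases h1 : ∀ v, E v ≤ 1
  · exact ⟨_, Relation.ReflTransGen.refl, fun v => sub_nonneg.2 (h1 v)⟩
  push Not at h1
  obtain ⟨v, hv⟩ := h1
  have hsmall : ∀ u, u ≠ v → E u ≤ 1 := fun u hu => by linarith [hpair hu]
  have hfar : ∀ {w}, w ≠ v → 1 ≤ E w → ∀ u, u ≠ v → u ≠ w → E u ≤ 0 := fun hwv hw u huv huw => by
    linarith [htriple huv huw hwv.symm]
  by_cases hrow : ∃ w, w ≠ v ∧ 1 ≤ E w ∧ w.1 = v.1
  · obtain ⟨w, hwv, hw, hw1⟩ := hrow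
    refine ⟨_, Relation.ReflTransGen.single ⟨(Finset.univ.filter fun u => u.1 = v.1)ᶜ, rfl⟩,
      fun u => ?_⟩
    rw [fire_rook_compl, Pi.sub_apply]
    by_cases hu : u.1 = v.1
    · rw [rookLap_relInd_of_mem (by simpa using hu)]
      simp only [relInd, Finset.mem_filter, Finset.mem_univ, true_and, hu]
      by_cases huv : u = v
      · subst huv
        simp
        linarith [hpair hwv]
      · simp
        linarith [hsmall u huv]
    · rw [rookLap_relInd_of_notMem (by simpa using hu)]
      simp only [relInd, Finset.mem_filter, Finset.mem_univ, true_and, hu]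
      simp
      exact hfar hwv hw u (fun h => hu (h ▸ rfl)) (fun h => hu (h ▸ hw1))
  by_cases hcol : ∃ w, w ≠ v ∧ 1 ≤ E w ∧ w.2 = v.2
  · obtain ⟨w, hwv, hw, hw1⟩ := hcol
    refine ⟨_, Relation.ReflTransGen.single ⟨(Finset.univ.filter fun u => u.2 = v.2)ᶜ, rfl⟩,
      fun u => ?_⟩
    rw [fire_rook_compl, Pi.sub_apply]
    by_cases hu : u.2 = v.2
    · rw [rookLap_relInd_of_mem (by simpa using hu)]
      simp only [relInd, Finset.mem_filter, Finset.mem_univ, true_and, hu]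
      by_cases huv : u = v
      · subst huv
        simp
        linarith [hpair hwv]
      · simp
        linarith [hsmall u huv]
    · rw [rookLap_relInd_of_notMem (by simpa using hu)]
      simp only [relInd, Finset.mem_filter, Finset.mem_univ, true_and, hu]
      simp
      exact hfar hwv hw u (fun h => hu (h ▸ rfl)) (fun h => hu (h ▸ hw1))
  push Not at hrow hcol
  refine ⟨_, Relation.ReflTransGen.single ⟨{v}ᶜ, rfl⟩, fun u => ?_⟩
  rw [fire_rook_compl, Pi.sub_apply]
  by_cases huv : u = v
  · subst huv
    rw [rookLap_relInd_singleton (by simp [Prod.ext_iff]), Fintype.card_fin, Fintype.card_fin]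
    linarith [hle u]
  · obtain ⟨i, j⟩ := u
    obtain ⟨a, b⟩ := v
    rw [rookLap_relInd_of_notMem (by simpa using huv)]
    by_cases hi : i = a
    · subst hi
      have hj : j ≠ b := fun h => huv (by rw [h])
      have := hrow _ huv
      simp [relInd, hj] at this ⊢
      linarith
    · by_cases hj : j = b
      · subst hj
        have := hcol _ huv
        simp [relInd, hi] at this ⊢
        linarith
      · simpa [relInd, hi, hj] using hsmall _ huv

/-- For `2 ≤ n ≤ m`, the `3`-gonality of `K_n □ K_m` equals `n * m`. -/
theorem three_gonality_rook (n m : ℕ) (hn : 2 ≤ n) (hnm : n ≤ m) :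
    kGonality (rook n m) 3 = n * m := by
  refine le_antisymm (Nat.sInf_le ⟨_, rankGE_three_one hn (hn.trans hnm), by simp [degD]⟩) ?_
  refine le_csInf ⟨n * m, _, rankGE_three_one hn (hn.trans hnm), by simp [degD]⟩ ?_
  rintro d ⟨D, hD, hd⟩
  have := hD.rookRankGEThree.card_mul_card_le (by simpa using hn) (by simpa using hn.trans hnm)
  rw [← Fintype.sum_prod_type' (f := fun i j => D (i, j))] at this
  simp only [Fintype.card_fin] at this
  have hle : ((n * m : ℕ) : ℤ) ≤ d := by
    push_cast
    exact this.trans hd.le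
  exact_mod_cast hle
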